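/- Let χ₁, χ₂ be primitive Dirichlet characters of conductors q₁, q₂ respectively, with q₁, q₂ > 1, and suppose both χ₁ and χ₂ are even (χ₁(−1) = χ₂(−1) = 1). Let γ = (a b; c·q₁q₂ d) ∈ Γ₀(q₁q₂) and set γ' = (d −c; −b·q₁q₂ a) ∈ Γ₀(q₁q₂). Then for all z, w in the upper half-plane ℍ, (τ(conj(χ₁))/(πi)) · ( f_{χ₁,χ₂}(γ·z) − (χ₁·conj(χ₂))(d)·f_{χ₁,χ₂}(z) ) = (τ(conj(χ₂))/(πi)) · ( f_{χ₂,χ₁}(γ'·w) − (χ₂·conj(χ₁))(a)·f_{χ₂,χ₁}(w) ). -/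

import Mathlib

open Complex

/-- `e(w) = exp(2πiw)`. -/
noncomputable def eC (w : ℂ) : ℂ := Complex.exp (2 * Real.pi * Complex.I * w)

/-- The holomorphic part `f_{χ₁,χ₂}(z) = ∑_{l≥1} ∑_{k≥1} (χ₁(l) conj(χ₂)(k) / l) e(klz)`. -/
noncomputable def fE {q₁ q₂ : ℕ} (χ₁ : DirichletCharacter ℂ q₁)
    (χ₂ : DirichletCharacter ℂ q₂) (z : ℂ) : ℂ :=
  ∑' l : ℕ+, ∑' k : ℕ+,
    χ₁ ((l : ℕ) : ZMod q₁) * (starRingEnd ℂ) (χ₂ ((k : ℕ) : ZMod q₂)) / (l : ℂ)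
      * eC ((k : ℂ) * (l : ℂ) * z)

/-- The Gauss sum `τ(χ) = ∑_{n mod q} χ(n) e(n/q)`. -/
noncomputable def gaussSum' {q : ℕ} (χ : DirichletCharacter ℂ q) : ℂ :=
  ∑ n ∈ Finset.range q, χ ((n : ℕ) : ZMod q) * eC ((n : ℂ) / (q : ℂ))

/-- The first Bernoulli function, `B₁(x) = x - ⌊x⌋ - 1/2` off ℤ, and `0` on ℤ. -/
noncomputable def B1 (x : ℝ) : ℝ := if Int.fract x = 0 then 0 else Int.fract x - 1 / 2


section gauss
variable {q : ℕ}

lemma eC_add (x y : ℂ) : eC (x + y) = eC x * eC y := by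
  simp only [eC, ← Complex.exp_add]; ring_nf

lemma eC_div_eq [NeZero q] (k : ℤ) : eC ((k : ℂ) / (q : ℂ)) = ZMod.stdAddChar (k : ZMod q) := by
  rw [ZMod.stdAddChar_coe, eC]
  ring_nf

lemma sum_zmod_eq_range [NeZero q] (F : ZMod q → ℂ) :
    ∑ v : ZMod q, F v = ∑ n ∈ Finset.range q, F (n : ZMod q) := by
  symm
  apply Finset.sum_bij' (fun (n : ℕ) _ => (n : ZMod q)) (fun v _ => v.val)
  · simp
  · intro a _; exact Finset.mem_range.2 (ZMod.val_lt a)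
  · intro a ha; exact ZMod.val_cast_of_lt (Finset.mem_range.1 ha)
  · intro a _; exact ZMod.natCast_zmod_val a
  · simp

lemma gaussSum'_eq [NeZero q] (χ : DirichletCharacter ℂ q) :
    gaussSum' χ = gaussSum χ ZMod.stdAddChar := by
  rw [gaussSum, sum_zmod_eq_range, gaussSum']
  refine Finset.sum_congr rfl fun n _ => ?_
  have := eC_div_eq (q := q) n
  push_cast at this
  rw [this]

lemma conj_char (χ : DirichletCharacter ℂ q) (a : ZMod q) :
    (starRingEnd ℂ) (χ a) = χ⁻¹ a := MulChar.star_apply' χ a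

lemma gauss_shift [NeZero q] (χ : DirichletCharacter ℂ q) (hχ : χ.IsPrimitive) (k : ZMod q) :
    ∑ v : ZMod q, χ v * ZMod.stdAddChar (k * v) = (starRingEnd ℂ) (χ k) * gaussSum' χ := by
  rw [gaussSum'_eq, conj_char, ← gaussSum_mulShift_of_isPrimitive _ hχ]
  simp [gaussSum, AddChar.mulShift_apply]

lemma gauss_mul [NeZero q] (χ : DirichletCharacter ℂ q) (hχ : χ.IsPrimitive)
    (hev : χ (-1) = 1) :
    gaussSum' χ * gaussSum' (χ.ringHomComp (starRingEnd ℂ)) = q := by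
  have h1 : gaussSum' (χ.ringHomComp (starRingEnd ℂ)) * gaussSum' χ =
      ∑ k : ZMod q, ∑ v : ZMod q, χ v * (ZMod.stdAddChar (k * v) * ZMod.stdAddChar k) := by
    rw [gaussSum'_eq (χ.ringHomComp _), gaussSum, Finset.sum_mul]
    refine Finset.sum_congr rfl fun k _ => ?_
    rw [MulChar.ringHomComp_apply, mul_right_comm, ← gauss_shift χ hχ, Finset.sum_mul]
    refine Finset.sum_congr rfl fun v _ => by ring
  rw [mul_comm, h1, Finset.sum_comm]
  have h2 : ∀ v : ZMod q, ∑ k : ZMod q, χ v * (ZMod.stdAddChar (k * v) * ZMod.stdAddChar k)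
      = χ v * (if v + 1 = 0 then (q : ℂ) else 0) := by
    intro v
    rw [← Finset.mul_sum]
    congr 1
    have := AddChar.sum_mulShift (v + 1) (ZMod.isPrimitive_stdAddChar q)
    rw [ZMod.card] at this
    push_cast at this
    rw [← this]
    refine Finset.sum_congr rfl fun k _ => ?_
    rw [← AddChar.map_add_eq_mul]; congr 1; ring
  simp_rw [h2]
  simp [add_eq_zero_iff_eq_neg, hev]

lemma gauss_ne_zero [NeZero q] (χ : DirichletCharacter ℂ q) (hχ : χ.IsPrimitive)
    (hev : χ (-1) = 1) : gaussSum' χ ≠ 0 := by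
  intro h
  have := gauss_mul χ hχ hev
  rw [h, zero_mul] at this
  exact NeZero.ne (q : ℂ) this.symm

lemma char_zero (hq : 1 < q) (χ : DirichletCharacter ℂ q) : χ 0 = 0 := by
  have : Fact (1 < q) := ⟨hq⟩
  exact MulChar.map_zero χ

lemma char_sum (hq : 1 < q) [NeZero q] (χ : DirichletCharacter ℂ q) (hχ : χ.IsPrimitive) :
    ∑ v : ZMod q, χ v = 0 := by
  apply MulChar.sum_eq_zero_of_ne_one
  rintro rfl
  rw [DirichletCharacter.isPrimitive_def, DirichletCharacter.conductor_one] at hχ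
  omega

lemma char_neg (χ : DirichletCharacter ℂ q) (hev : χ (-1) = 1) (a : ZMod q) : χ (-a) = χ a := by
  rw [neg_eq_neg_one_mul, map_mul, hev, one_mul]

lemma norm_char_le (χ : DirichletCharacter ℂ q) (a : ZMod q) : ‖χ a‖ ≤ 1 := χ.norm_le_one a

end gauss


section deriv
variable {q₁ q₂ : ℕ}

lemma norm_eC (w : ℂ) : ‖eC w‖ = Real.exp (-(2 * Real.pi * w.im)) := by
  rw [eC, Complex.norm_exp]
  congr 1
  simp

lemma norm_eC_kl (k l : ℕ+) (z : ℂ) :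
    ‖eC ((k : ℂ) * (l : ℂ) * z)‖ = Real.exp (-(2 * Real.pi * z.im)) ^ ((k : ℕ) * (l : ℕ)) := by
  rw [norm_eC, ← Real.exp_nat_mul]
  congr 1
  have : ((k : ℂ) * (l : ℂ) * z).im = (k : ℝ) * l * z.im := by
    rw [show (k : ℂ) * (l : ℂ) = (((k : ℝ) * (l : ℝ) : ℝ) : ℂ) by push_cast; rfl,
      Complex.im_ofReal_mul]
  rw [this]; push_cast; ring

lemma summable_bound {r : ℝ} (h0 : 0 < r) (h1 : r < 1) :
    Summable (fun p : ℕ+ × ℕ+ => (p.2 : ℝ) * r ^ ((p.2 : ℕ) * (p.1 : ℕ))) := by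
  have hn : ‖r‖ < 1 := by rw [Real.norm_eq_abs, abs_of_pos h0]; exact h1
  have s1 : Summable (fun l : ℕ+ => r ^ (l : ℕ)) :=
    (summable_geometric_of_lt_one h0.le h1).comp_injective PNat.coe_injective
  have s2 : Summable (fun k : ℕ+ => (k : ℝ) * r ^ (k : ℕ)) := by
    have := summable_pow_mul_geometric_of_norm_lt_one 1 hn
    simp only [pow_one] at this
    exact this.comp_injective PNat.coe_injective
  have s3 := (s1.mul_of_nonneg s2 (fun _ => by positivity) (fun _ => by positivity)).mul_left r⁻¹
  refine Summable.of_nonneg_of_le (fun p => by positivity) (fun p => ?_) s3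
  obtain ⟨l, k⟩ := p
  have hl : 1 ≤ (l : ℕ) := l.2
  have hk : 1 ≤ (k : ℕ) := k.2
  have h : (l : ℕ) + k ≤ (k : ℕ) * l + 1 := by nlinarith
  have h' : r ^ ((k : ℕ) * (l : ℕ) + 1) ≤ r ^ ((l : ℕ) + k) :=
    pow_le_pow_of_le_one h0.le h1.le h
  have : r ^ ((k : ℕ) * (l : ℕ)) ≤ r⁻¹ * (r ^ (l : ℕ) * r ^ (k : ℕ)) := by
    rw [← pow_add, le_inv_mul_iff₀ h0, mul_comm, ← pow_succ]; exact h'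
  calc (k : ℝ) * r ^ ((k : ℕ) * (l : ℕ)) ≤ k * (r⁻¹ * (r ^ (l : ℕ) * r ^ (k : ℕ))) := by gcongr
    _ = _ := by ring

lemma exp_lt_one' {y : ℝ} (hy : 0 < y) : Real.exp (-(2 * Real.pi * y)) < 1 := by
  rw [Real.exp_lt_one_iff]
  have := Real.pi_pos
  have : 0 < 2 * Real.pi * y := by positivity
  linarith

noncomputable def fTerm (χ₁ : DirichletCharacter ℂ q₁) (χ₂ : DirichletCharacter ℂ q₂)
    (p : ℕ+ × ℕ+) (z : ℂ) : ℂ :=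
  χ₁ ((p.1 : ℕ) : ZMod q₁) * (starRingEnd ℂ) (χ₂ ((p.2 : ℕ) : ZMod q₂)) / (p.1 : ℂ)
      * eC ((p.2 : ℂ) * (p.1 : ℂ) * z)

noncomputable def dTerm (χ₁ : DirichletCharacter ℂ q₁) (χ₂ : DirichletCharacter ℂ q₂)
    (p : ℕ+ × ℕ+) (z : ℂ) : ℂ :=
  χ₁ ((p.1 : ℕ) : ZMod q₁) * ((starRingEnd ℂ) (χ₂ ((p.2 : ℕ) : ZMod q₂)) * ((p.2 : ℂ)
      * eC ((p.2 : ℂ) * (p.1 : ℂ) * z)))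

noncomputable def dsum (χ₁ : DirichletCharacter ℂ q₁) (χ₂ : DirichletCharacter ℂ q₂) (z : ℂ) : ℂ :=
  ∑' p : ℕ+ × ℕ+, dTerm χ₁ χ₂ p z

lemma norm_dTerm_le (χ₁ : DirichletCharacter ℂ q₁) (χ₂ : DirichletCharacter ℂ q₂)
    (p : ℕ+ × ℕ+) {z : ℂ} {ε : ℝ} (hz : ε ≤ z.im) :
    ‖dTerm χ₁ χ₂ p z‖ ≤ (p.2 : ℝ) * Real.exp (-(2 * Real.pi * ε)) ^ ((p.2 : ℕ) * (p.1 : ℕ)) := by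
  rw [dTerm, norm_mul, norm_mul, norm_mul, norm_eC_kl, RCLike.norm_conj]
  have h3 : ‖((p.2 : ℕ+) : ℂ)‖ = (p.2 : ℝ) := by simp
  rw [h3]
  calc _ ≤ 1 * (1 * ((p.2 : ℝ) * Real.exp (-(2 * Real.pi * z.im)) ^ ((p.2 : ℕ) * (p.1 : ℕ)))) := by
        gcongr <;> exact norm_char_le _ _
    _ ≤ _ := by
        rw [one_mul, one_mul]
        have := Real.pi_pos
        gcongr

lemma norm_fTerm_le (χ₁ : DirichletCharacter ℂ q₁) (χ₂ : DirichletCharacter ℂ q₂)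
    (p : ℕ+ × ℕ+) {z : ℂ} {ε : ℝ} (hz : ε ≤ z.im) :
    ‖fTerm χ₁ χ₂ p z‖ ≤ (p.2 : ℝ) * Real.exp (-(2 * Real.pi * ε)) ^ ((p.2 : ℕ) * (p.1 : ℕ)) := by
  refine le_trans ?_ (norm_dTerm_le χ₁ χ₂ p hz)
  have h1 : (1 : ℝ) ≤ p.1 := by exact_mod_cast p.1.2
  have h2 : (1 : ℝ) ≤ p.2 := by exact_mod_cast p.2.2
  have h3 : ‖((p.2 : ℕ+) : ℂ)‖ = (p.2 : ℝ) := by simp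
  have h4 : ‖((p.1 : ℕ+) : ℂ)‖ = (p.1 : ℝ) := by simp
  rw [dTerm, fTerm, norm_mul, norm_mul, norm_mul, norm_mul, norm_div, norm_mul, h3, h4]
  rw [div_mul_eq_mul_div, div_le_iff₀ (by linarith)]
  have : 0 ≤ ‖χ₁ ((p.1 : ℕ) : ZMod q₁)‖ * (‖(starRingEnd ℂ) (χ₂ ((p.2 : ℕ) : ZMod q₂))‖ * ‖eC ((p.2 : ℂ) * (p.1 : ℂ) * z)‖) := by
    positivity
  have h5 : (1 : ℝ) ≤ p.2 * p.1 := by nlinarith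
  nlinarith [mul_le_mul_of_nonneg_left h5 this]

lemma summable_fTerm (χ₁ : DirichletCharacter ℂ q₁) (χ₂ : DirichletCharacter ℂ q₂) {z : ℂ}
    (hz : 0 < z.im) : Summable (fun p => fTerm χ₁ χ₂ p z) :=
  Summable.of_norm_bounded (summable_bound (Real.exp_pos _) (exp_lt_one' hz))
    (fun p => norm_fTerm_le χ₁ χ₂ p le_rfl)

lemma summable_dTerm (χ₁ : DirichletCharacter ℂ q₁) (χ₂ : DirichletCharacter ℂ q₂) {z : ℂ}
    (hz : 0 < z.im) : Summable (fun p => dTerm χ₁ χ₂ p z) :=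
  Summable.of_norm_bounded (summable_bound (Real.exp_pos _) (exp_lt_one' hz))
    (fun p => norm_dTerm_le χ₁ χ₂ p le_rfl)

lemma fE_eq (χ₁ : DirichletCharacter ℂ q₁) (χ₂ : DirichletCharacter ℂ q₂) {z : ℂ}
    (hz : 0 < z.im) : fE χ₁ χ₂ z = ∑' p : ℕ+ × ℕ+, fTerm χ₁ χ₂ p z := by
  rw [(summable_fTerm χ₁ χ₂ hz).tsum_prod]
  rfl

lemma hasDerivAt_fE (χ₁ : DirichletCharacter ℂ q₁) (χ₂ : DirichletCharacter ℂ q₂) {z : ℂ}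
    (hz : 0 < z.im) : HasDerivAt (fE χ₁ χ₂) (2 * Real.pi * I * dsum χ₁ χ₂ z) z := by
  set t : Set ℂ := {w | z.im / 2 < w.im} with ht
  have hto : IsOpen t := isOpen_lt continuous_const Complex.continuous_im
  have htc : Convex ℝ t := convex_halfSpace_im_gt _
  have hzt : z ∈ t := by change z.im / 2 < z.im; linarith
  have hz2 : 0 < z.im / 2 := by linarith
  have key := hasDerivAt_tsum_of_isPreconnected
    (g := fTerm χ₁ χ₂) (g' := fun p w => 2 * Real.pi * I * dTerm χ₁ χ₂ p w)
    ((summable_bound (Real.exp_pos _) (exp_lt_one' hz2)).mul_left ‖(2 * Real.pi * I : ℂ)‖)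
    hto htc.isPreconnected ?_ ?_ hzt (summable_fTerm χ₁ χ₂ hz) hzt
  · rw [tsum_mul_left] at key
    refine key.congr_of_eventuallyEq ?_
    filter_upwards [hto.mem_nhds hzt] with w hw
    exact fE_eq χ₁ χ₂ (lt_trans hz2 hw)
  · intro p y _
    have h1 : ((p.1 : ℕ+) : ℂ) ≠ 0 := by simp
    have : HasDerivAt (fun w => eC ((p.2 : ℂ) * (p.1 : ℂ) * w))
        (eC ((p.2 : ℂ) * (p.1 : ℂ) * y) * (2 * Real.pi * I * ((p.2 : ℂ) * (p.1 : ℂ)))) y := by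
      unfold eC
      apply HasDerivAt.cexp
      have := ((hasDerivAt_id y).const_mul ((p.2 : ℂ) * (p.1 : ℂ))).const_mul (2 * Real.pi * I)
      simpa using this
    have h2 := this.const_mul (χ₁ ((p.1 : ℕ) : ZMod q₁) * (starRingEnd ℂ) (χ₂ ((p.2 : ℕ) : ZMod q₂)) / (p.1 : ℂ))
    unfold fTerm dTerm
    refine h2.congr_deriv ?_
    generalize eC ((p.2 : ℂ) * (p.1 : ℂ) * y) = E
    field_simp
  · intro p y hy
    rw [norm_mul]
    gcongr
    exact norm_dTerm_le χ₁ χ₂ p (le_of_lt hy)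

end deriv


section wp

/-- The period pair `(1, q z)`. -/
noncomputable def pp (q : ℕ) (hq : 0 < q) (z : ℂ) (hz : 0 < z.im) : PeriodPair where
  ω₁ := 1
  ω₂ := q * z
  indep := by
    rw [LinearIndependent.pair_iff]
    intro s t h
    have him := congrArg Complex.im h
    have hre := congrArg Complex.re h
    have hq' : (0 : ℝ) < q := by exact_mod_cast hq
    simp at him hre
    have ht : t = 0 := by
      rcases him with h | h | h
      · exact h
      · omega
      · exact absurd h hz.ne'
    subst ht
    simpa using hre

lemma mem_pp {q : ℕ} {hq : 0 < q} {z : ℂ} {hz : 0 < z.im} {x : ℂ} :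
    x ∈ (pp q hq z hz).lattice ↔ ∃ m n : ℤ, (m : ℂ) + n * (q * z) = x := by
  rw [PeriodPair.mem_lattice]
  simp [pp]

lemma wp_scale (L L' : PeriodPair) (j : ℂ) (hj : j ≠ 0)
    (h : ∀ x, x ∈ L.lattice ↔ j * x ∈ L'.lattice) (x : ℂ) :
    L.weierstrassP x = j ^ 2 * L'.weierstrassP (j * x) := by
  unfold PeriodPair.weierstrassP
  let e : L.lattice ≃ L'.lattice :=
    { toFun := fun x => ⟨j * x, (h x).1 x.2⟩
      invFun := fun y => ⟨j⁻¹ * y, by rw [h, mul_inv_cancel_left₀ hj]; exact y.2⟩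
      left_inv := fun x => by simp [hj]
      right_inv := fun x => by simp [hj] }
  rw [← e.tsum_eq, ← tsum_mul_left]
  refine tsum_congr fun l => ?_
  have : ((e l : L'.lattice) : ℂ) = j * l := rfl
  rw [this, ← mul_sub, mul_pow, mul_pow]
  generalize (x - l) ^ 2 = A
  generalize (l : ℂ) ^ 2 = B
  have hj2 : j ^ 2 ≠ 0 := pow_ne_zero 2 hj
  rw [mul_sub, one_div, one_div, one_div, one_div, mul_inv, mul_inv, mul_inv_cancel_left₀ hj2,
    mul_inv_cancel_left₀ hj2]

variable {q₁ q₂ : ℕ}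

/-- `℘(m z + n / q₂)` for the lattice `(1, q₁ z)`. -/
noncomputable def wpt (q₁ q₂ : ℕ) (h₁ : 0 < q₁) (z : ℂ) (hz : 0 < z.im) (m n : ℤ) : ℂ :=
  (pp q₁ h₁ z hz).weierstrassP ((m : ℂ) * z + n / q₂)

lemma wpt_congr (h₁ : 0 < q₁) (h₂ : 0 < q₂) (z : ℂ) (hz : 0 < z.im) (m n m' n' : ℤ)
    (hm : (m : ZMod q₁) = m') (hn : (n : ZMod q₂) = n') :
    wpt q₁ q₂ h₁ z hz m n = wpt q₁ q₂ h₁ z hz m' n' := by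
  obtain ⟨s, hs⟩ := (ZMod.intCast_eq_intCast_iff_dvd_sub _ _ _).1 hm
  obtain ⟨t, ht⟩ := (ZMod.intCast_eq_intCast_iff_dvd_sub _ _ _).1 hn
  have hm' : m' = m + q₁ * s := by linarith
  have hn' : n' = n + q₂ * t := by linarith
  subst hm' hn'
  have hq : (q₂ : ℂ) ≠ 0 := by exact_mod_cast h₂.ne'
  unfold wpt
  have hmem : (t : ℂ) + s * (q₁ * z) ∈ (pp q₁ h₁ z hz).lattice := mem_pp.2 ⟨t, s, rfl⟩
  rw [← (pp q₁ h₁ z hz).weierstrassP_add_coe ((m : ℂ) * z + n / q₂) ⟨_, hmem⟩]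
  congr 1
  push_cast
  field_simp
  ring

lemma denom_ne_zero' (c d : ℤ) (h : c ≠ 0 ∨ d ≠ 0) (z : ℂ) (hz : 0 < z.im) :
    (c : ℂ) * z + d ≠ 0 := by
  intro h0
  have him := congrArg Complex.im h0
  have hre := congrArg Complex.re h0
  simp at him hre
  rcases him with h1 | h1
  · subst h1
    simp at hre
    subst hre
    simp at h
  · exact hz.ne' h1

lemma im_mobius (a b c d : ℤ) (hdet : a * d - b * c = 1) (z : ℂ) (hz : 0 < z.im) :
    0 < (((a : ℂ) * z + b) / ((c : ℂ) * z + d)).im := by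
  have hj : (c : ℂ) * z + d ≠ 0 := by
    apply denom_ne_zero' _ _ _ _ hz
    by_contra! h
    rw [h.1, h.2] at hdet
    simp at hdet
  have hn : 0 < Complex.normSq ((c : ℂ) * z + d) := Complex.normSq_pos.2 hj
  have hdet' : (a : ℝ) * d - b * c = 1 := by exact_mod_cast hdet
  rw [Complex.div_im, ← sub_div]
  apply div_pos _ hn
  simp
  have : a * z.im * (c * z.re + d) - (a * z.re + b) * (c * z.im) = (a * d - b * c : ℝ) * z.im := by
    ring
  rw [hdet', one_mul] at this
  linarith

lemma wpt_mobius (h₁ : 0 < q₁) (h₂ : 0 < q₂) (a b c d : ℤ)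
    (hdet : a * d - b * (c * (q₁ * q₂ : ℕ)) = 1) (z : ℂ) (hz : 0 < z.im) (z' : ℂ)
    (hz' : 0 < z'.im) (hzz : z' = ((a : ℂ) * z + b) / (((c * (q₁ * q₂ : ℕ) : ℤ) : ℂ) * z + d))
    (m n : ℤ) :
    wpt q₁ q₂ h₁ z' hz' m n =
      (((c * (q₁ * q₂ : ℕ) : ℤ) : ℂ) * z + d) ^ 2 * wpt q₁ q₂ h₁ z hz (m * a) (n * d) := by
  set j : ℂ := ((c * (q₁ * q₂ : ℕ) : ℤ) : ℂ) * z + d with hj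
  have hj0 : j ≠ 0 := by
    apply denom_ne_zero' _ _ _ _ hz
    by_contra! h
    rw [h.1, h.2] at hdet
    simp at hdet
  have hq₂ : (q₂ : ℂ) ≠ 0 := by exact_mod_cast h₂.ne'
  have hjz : j * z' = a * z + b := by rw [hzz]; field_simp
  have hdetC : (a : ℂ) * d - b * (c * (q₁ * q₂)) = 1 := by exact_mod_cast hdet
  have hj' : j = c * (q₁ * q₂) * z + d := by rw [hj]; push_cast; ring
  unfold wpt
  rw [wp_scale (pp q₁ h₁ z' hz') (pp q₁ h₁ z hz) j hj0]
  · congr 1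
    change _ = wpt q₁ q₂ h₁ z hz (m * a) (n * d)
    rw [wpt_congr h₁ h₂ z hz (m * a) (n * d) (m * a + n * (c * q₁)) (n * d + m * (b * q₂))
      (by simp) (by simp), wpt]
    congr 1
    have : j * ((m : ℂ) * z' + n / q₂) = m * (j * z') + j * (n / q₂) := by ring
    rw [this, hjz, hj']
    push_cast
    field_simp
    ring
  · intro x
    rw [mem_pp, mem_pp]
    constructor
    · rintro ⟨s, t, rfl⟩
      refine ⟨s * d + t * (q₁ * b), s * (c * q₂) + t * a, ?_⟩
      have : j * ((s : ℂ) + t * (q₁ * z')) = s * j + t * q₁ * (j * z') := by ring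
      rw [this, hjz, hj']
      push_cast
      ring
    · rintro ⟨s, t, h⟩
      refine ⟨s * a - t * (q₁ * b), -(s * (c * q₂)) + t * d, ?_⟩
      apply mul_left_cancel₀ hj0
      rw [← h]
      have : j * (((s * a - t * (q₁ * b) : ℤ) : ℂ) + ((-(s * (c * q₂)) + t * d : ℤ) : ℂ) * (q₁ * z'))
        = j * ((s * a - t * (q₁ * b) : ℤ) : ℂ)
          + ((-(s * (c * q₂)) + t * d : ℤ) : ℂ) * q₁ * (j * z') := by ring
      rw [this, hjz, hj']
      push_cast
      linear_combination (s + t * (q₁ * z)) * hdetC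

lemma im_fricke {N : ℕ} (hN : 0 < N) (z : ℂ) (hz : 0 < z.im) : 0 < (-1 / ((N : ℂ) * z)).im := by
  have hN' : (0 : ℝ) < N := by exact_mod_cast hN
  have hz0 : z ≠ 0 := by rintro rfl; simp at hz
  have : 0 < Complex.normSq ((N : ℂ) * z) :=
    Complex.normSq_pos.2 (mul_ne_zero (by exact_mod_cast hN.ne') hz0)
  rw [Complex.div_im]
  rw [← sub_div]
  apply div_pos _ this
  have h2 : ((N : ℂ) * z).im = N * z.im := by simp
  rw [h2]
  simp
  positivity

lemma wpt_fricke (h₁ : 0 < q₁) (h₂ : 0 < q₂) (z : ℂ) (hz : 0 < z.im) (z' : ℂ)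
    (hz' : 0 < z'.im) (hzz : z' = -1 / (((q₁ * q₂ : ℕ) : ℂ) * z)) (m n : ℤ) :
    wpt q₁ q₂ h₁ z' hz' m n = (q₂ * z) ^ 2 * wpt q₂ q₁ h₂ z hz n (-m) := by
  have hq₂ : (q₂ : ℂ) ≠ 0 := by exact_mod_cast h₂.ne'
  have hq₁ : (q₁ : ℂ) ≠ 0 := by exact_mod_cast h₁.ne'
  have hz0 : z ≠ 0 := by rintro rfl; simp at hz
  unfold wpt
  push_cast at hzz
  rw [wp_scale (pp q₁ h₁ z' hz') (pp q₂ h₂ z hz) (q₂ * z) (mul_ne_zero hq₂ hz0)]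
  · congr 2
    rw [hzz]
    push_cast
    field_simp
    ring
  · intro x
    rw [mem_pp, mem_pp]
    constructor
    · rintro ⟨s, t, rfl⟩
      refine ⟨-t, s, ?_⟩
      rw [hzz]
      push_cast
      field_simp
      ring
    · rintro ⟨s, t, h⟩
      refine ⟨t, -s, ?_⟩
      apply mul_left_cancel₀ (mul_ne_zero hq₂ hz0)
      rw [← h, hzz]
      push_cast
      field_simp
      ring

/-- The weight two Eisenstein series as a combination of division values of `℘`. -/
noncomputable def gsum (h₁ : 0 < q₁) [NeZero q₁] [NeZero q₂]
    (χ₁ : DirichletCharacter ℂ q₁) (χ₂ : DirichletCharacter ℂ q₂)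
    (z : ℂ) (hz : 0 < z.im) : ℂ :=
  ∑ u : ZMod q₁, ∑ v : ZMod q₂, χ₁ u * χ₂ v * wpt q₁ q₂ h₁ z hz u.val v.val

lemma gsum_mobius (h₁ : 0 < q₁) (h₂ : 0 < q₂) [NeZero q₁] [NeZero q₂]
    (χ₁ : DirichletCharacter ℂ q₁) (χ₂ : DirichletCharacter ℂ q₂) (a b c d : ℤ)
    (hdet : a * d - b * (c * (q₁ * q₂ : ℕ)) = 1) (z : ℂ) (hz : 0 < z.im) (z' : ℂ)
    (hz' : 0 < z'.im) (hzz : z' = ((a : ℂ) * z + b) / (((c * (q₁ * q₂ : ℕ) : ℤ) : ℂ) * z + d)) :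
    gsum h₁ χ₁ χ₂ z' hz' = (((c * (q₁ * q₂ : ℕ) : ℤ) : ℂ) * z + d) ^ 2 *
      (χ₁ (d : ZMod q₁) * (starRingEnd ℂ) (χ₂ (d : ZMod q₂)) * gsum h₁ χ₁ χ₂ z hz) := by
  have had₁ : (a : ZMod q₁) * d = 1 := by
    have := congrArg (Int.cast : ℤ → ZMod q₁) hdet
    simpa using this
  have had₂ : (a : ZMod q₂) * d = 1 := by
    have := congrArg (Int.cast : ℤ → ZMod q₂) hdet
    simpa using this
  let ua : (ZMod q₁)ˣ := ⟨a, d, had₁, by rw [mul_comm]; exact had₁⟩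
  let vd : (ZMod q₂)ˣ := ⟨d, a, by rw [mul_comm]; exact had₂, had₂⟩
  have hc : (starRingEnd ℂ) (χ₂ (d : ZMod q₂)) = χ₂ (a : ZMod q₂) := by
    rw [conj_char, MulChar.inv_apply]
    congr 1
    exact Ring.inverse_unit vd
  rw [hc]
  unfold gsum
  rw [← Equiv.sum_comp (Units.mulRight ua)
    (fun u => ∑ v : ZMod q₂, χ₁ u * χ₂ v * wpt q₁ q₂ h₁ z hz u.val v.val), Finset.mul_sum,
    Finset.mul_sum]
  refine Finset.sum_congr rfl fun u _ => ?_
  rw [← Equiv.sum_comp (Units.mulRight vd)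
    (fun v => χ₁ _ * χ₂ v * wpt q₁ q₂ h₁ z hz (ZMod.val _) v.val), Finset.mul_sum,
    Finset.mul_sum]
  refine Finset.sum_congr rfl fun v _ => ?_
  rw [wpt_mobius h₁ h₂ a b c d hdet z hz z' hz' hzz]
  have e1 : (Units.mulRight ua) u = u * a := rfl
  have e2 : (Units.mulRight vd) v = v * d := rfl
  rw [e1, e2]
  rw [wpt_congr h₁ h₂ z hz (u.val * a) (v.val * d) ((u * a).val) ((v * d).val) (by simp) (by simp)]
  have f1 : χ₁ (u * a) * χ₁ d = χ₁ u := by rw [← map_mul, mul_assoc, had₁, mul_one]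
  have f2 : χ₂ (v * d) * χ₂ a = χ₂ v := by rw [← map_mul, mul_assoc, mul_comm (d : ZMod q₂), had₂, mul_one]
  rw [← f1, ← f2]
  ring

lemma gsum_fricke (h₁ : 0 < q₁) (h₂ : 0 < q₂) [NeZero q₁] [NeZero q₂]
    (χ₁ : DirichletCharacter ℂ q₁) (χ₂ : DirichletCharacter ℂ q₂) (hev : χ₁ (-1) = 1)
    (z : ℂ) (hz : 0 < z.im) (z' : ℂ)
    (hz' : 0 < z'.im) (hzz : z' = -1 / (((q₁ * q₂ : ℕ) : ℂ) * z)) :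
    gsum h₁ χ₁ χ₂ z' hz' = (q₂ * z) ^ 2 * gsum h₂ χ₂ χ₁ z hz := by
  unfold gsum
  rw [← Equiv.sum_comp (Equiv.neg _), Finset.sum_comm, Finset.mul_sum]
  refine Finset.sum_congr rfl fun v _ => ?_
  rw [Finset.mul_sum]
  refine Finset.sum_congr rfl fun u _ => ?_
  rw [wpt_fricke h₁ h₂ z hz z' hz' hzz, Equiv.neg_apply, char_neg χ₁ hev,
    wpt_congr h₂ h₁ z hz v.val (-(-u).val) v.val u.val rfl (by simp)]
  ring

end wp


section qexp
variable {q₁ q₂ : ℕ}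

lemma summable_k_eC {x : ℂ} (hx : 0 < x.im) :
    Summable (fun k : ℕ+ => (k : ℂ) * eC ((k : ℂ) * x)) := by
  have hn : ‖Real.exp (-(2 * Real.pi * x.im))‖ < 1 := by
    rw [Real.norm_eq_abs, abs_of_pos (Real.exp_pos _)]; exact exp_lt_one' hx
  have := summable_pow_mul_geometric_of_norm_lt_one 1 hn
  simp only [pow_one] at this
  refine Summable.of_norm_bounded (this.comp_injective PNat.coe_injective) fun k => ?_
  have h := norm_eC_kl k 1 x
  simp only [PNat.one_coe, Nat.cast_one, mul_one] at h
  rw [norm_mul, h]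
  simp

lemma lipschitz_two {x : ℂ} (hx : 0 < x.im) :
    HasSum (fun n : ℤ => 1 / (x + n) ^ 2)
      ((2 * Real.pi * I) ^ 2 * ∑' k : ℕ+, (k : ℂ) * eC ((k : ℂ) * x)) := by
  have hs : Summable (fun n : ℤ => 1 / (x + n) ^ 2) := by
    have := EisensteinSeries.linear_right_summable x 1 (k := 2) le_rfl
    refine this.congr fun n => ?_
    simp [zpow_ofNat]
  have h := EisensteinSeries.qExpansion_identity_pnat (k := 1) le_rfl ⟨x, hx⟩
  have h2 := hs.hasSum
  simp only [UpperHalfPlane.coe_mk] at h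
  norm_num at h
  simp only [one_div] at h2 ⊢
  rw [h] at h2
  convert h2 using 1
  congr 1
  refine tsum_congr fun k => ?_
  rw [eC, ← Complex.exp_nat_mul]
  ring_nf

/-- inner sum -/
noncomputable def bsum (χ₂ : DirichletCharacter ℂ q₂) (z : ℂ) (l : ℕ) : ℂ :=
  ∑' k : ℕ+, (starRingEnd ℂ) (χ₂ ((k : ℕ) : ZMod q₂)) * ((k : ℂ) * eC ((k : ℂ) * (l : ℂ) * z))

lemma im_aux {z : ℂ} (hz : 0 < z.im) {l : ℕ} (hl : 0 < l) (ε n : ℤ) (q : ℕ) :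
    0 < ((l : ℂ) * z + ε * (n / q)).im := by
  have : ((l : ℂ) * z + ε * (n / q)).im = l * z.im := by
    have : (ε : ℂ) * (n / q) = ((ε * (n / q) : ℝ) : ℂ) := by push_cast; rfl
    rw [this, add_im, ofReal_im]; simp
  rw [this]
  have : (0 : ℝ) < l := by exact_mod_cast hl
  positivity

lemma bsum_eq [NeZero q₂] (χ₂ : DirichletCharacter ℂ q₂) (hχ₂ : χ₂.IsPrimitive)
    (hev : χ₂ (-1) = 1) {z : ℂ} (hz : 0 < z.im) {l : ℕ} (hl : 0 < l) (ε : ℤ)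
    (hε : ε = 1 ∨ ε = -1) :
    ∑ v : ZMod q₂, χ₂ v *
      (∑' k : ℕ+, (k : ℂ) * eC ((k : ℂ) * ((l : ℂ) * z + ε * (((v.val : ℤ) : ℂ) / q₂)))) =
    gaussSum' χ₂ * bsum χ₂ z l := by
  simp_rw [← tsum_mul_left]
  have hsum : ∀ v ∈ (Finset.univ : Finset (ZMod q₂)), Summable (fun k : ℕ+ => χ₂ v * ((k : ℂ) *
      eC ((k : ℂ) * ((l : ℂ) * z + ε * (((v.val : ℤ) : ℂ) / q₂))))) := by
    intro v _
    have hi := im_aux hz hl ε (v.val : ℤ) q₂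
    exact (summable_k_eC hi).mul_left (χ₂ v)
  rw [← Summable.tsum_finsetSum hsum, bsum, ← tsum_mul_left]
  refine tsum_congr fun k => ?_
  have h1 : ∀ v : ZMod q₂, χ₂ v * ((k : ℂ) *
      eC ((k : ℂ) * ((l : ℂ) * z + ε * (((v.val : ℤ) : ℂ) / q₂)))) =
      ((k : ℂ) * eC ((k : ℂ) * (l : ℂ) * z)) *
        (χ₂ v * ZMod.stdAddChar ((ε * ((k : ℕ) : ℤ) : ℤ) * v : ZMod q₂)) := by
    intro v
    have : (k : ℂ) * ((l : ℂ) * z + ε * (((v.val : ℤ) : ℂ) / q₂)) =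
      (k : ℂ) * (l : ℂ) * z + ((ε * ((k : ℕ) : ℤ) * (v.val : ℤ) : ℤ) : ℂ) / q₂ := by
      push_cast; ring
    rw [this, eC_add, eC_div_eq]
    push_cast
    rw [ZMod.natCast_zmod_val]
    ring
  rw [Finset.sum_congr rfl (fun v _ => h1 v), ← Finset.mul_sum, gauss_shift χ₂ hχ₂]
  have h2 : χ₂ ((ε * ((k : ℕ) : ℤ) : ℤ) : ZMod q₂) = χ₂ ((k : ℕ) : ZMod q₂) := by
    rcases hε with rfl | rfl
    · simp
    · push_cast
      rw [neg_one_mul, char_neg χ₂ hev]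
  rw [h2]
  ring

lemma inner_hasSum {z : ℂ} (hz : 0 < z.im) (l : ℤ) (hl : l ≠ 0) (n : ℤ) (q : ℕ) :
    HasSum (fun s : ℤ => 1 / ((l : ℂ) * z + n / q - s) ^ 2)
      ((2 * Real.pi * I) ^ 2 * ∑' k : ℕ+, (k : ℂ) *
        eC ((k : ℂ) * ((l.natAbs : ℂ) * z + (l.sign : ℤ) * ((n : ℂ) / q)))) := by
  have h := lipschitz_two (im_aux hz (Int.natAbs_pos.2 hl) l.sign n q)
  rcases lt_or_gt_of_ne hl with h0 | h0
  · convert h using 1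
    ext s
    have h1 : l.sign = -1 := Int.sign_eq_neg_one_of_neg h0
    have h2 : (l.natAbs : ℂ) = -l := by
      have : (l.natAbs : ℤ) = -l := by omega
      rw [← Int.cast_natCast, this]; push_cast; rfl
    rw [h1, h2]
    congr 1
    push_cast
    ring
  · rw [← (Equiv.neg ℤ).hasSum_iff] at h
    convert h using 1
    ext s
    have h1 : l.sign = 1 := Int.sign_eq_one_of_pos h0
    have h2 : (l.natAbs : ℂ) = l := by
      have : (l.natAbs : ℤ) = l := by omega
      rw [← Int.cast_natCast, this]
    simp only [Function.comp, Equiv.neg_apply]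
    rw [h1, h2]
    congr 1
    push_cast
    ring

lemma hasSum_int (h₁ : 1 < q₁) (χ₁ : DirichletCharacter ℂ q₁) (χ₂ : DirichletCharacter ℂ q₂)
    (hev : χ₁ (-1) = 1) {z : ℂ} (hz : 0 < z.im) :
    HasSum (fun l : ℤ => χ₁ (l : ZMod q₁) * bsum χ₂ z l.natAbs) (2 * dsum χ₁ χ₂ z) := by
  have hs := summable_dTerm χ₁ χ₂ hz
  have h1 : HasSum (fun l : ℕ+ => χ₁ ((l : ℕ) : ZMod q₁) * bsum χ₂ z (l : ℕ)) (dsum χ₁ χ₂ z) := by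
    refine hs.hasSum.prod_fiberwise fun l => ?_
    rw [bsum, ← tsum_mul_left]
    exact (hs.prod_factor l).hasSum
  have h2 : HasSum (fun n : ℕ => χ₁ ((n + 1 : ℕ) : ZMod q₁) * bsum χ₂ z (n + 1))
      (dsum χ₁ χ₂ z) := by
    rw [← Equiv.pnatEquivNat.symm.hasSum_iff] at h1
    refine Eq.mp (congrArg (fun f => HasSum f _) ?_) h1
    ext n
    simp [Equiv.pnatEquivNat, Function.comp]
  have h3 := HasSum.of_add_one_of_neg_add_one
    (f := fun l : ℤ => χ₁ (l : ZMod q₁) * bsum χ₂ z l.natAbs)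
    (m := dsum χ₁ χ₂ z) (m' := dsum χ₁ χ₂ z) ?_ ?_
  · convert h3 using 1
    simp [char_zero h₁]
    ring
  · convert h2 using 1
    ext n
    have : ((n : ℤ) + 1).natAbs = n + 1 := by omega
    rw [this]
    push_cast
    rfl
  · convert h2 using 1
    ext n
    have : (-((n : ℤ) + 1)).natAbs = n + 1 := by omega
    rw [this]
    push_cast
    rw [char_neg χ₁ hev]

lemma hasSum_int' (h₁ : 1 < q₁) [NeZero q₁] (χ₁ : DirichletCharacter ℂ q₁)
    (χ₂ : DirichletCharacter ℂ q₂)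
    (hev : χ₁ (-1) = 1) {z : ℂ} (hz : 0 < z.im) :
    HasSum (fun m : ℤ => ∑ u : ZMod q₁, χ₁ u * bsum χ₂ z ((u.val : ℤ) - m * q₁).natAbs)
      (2 * dsum χ₁ χ₂ z) := by
  have h := hasSum_int h₁ χ₁ χ₂ hev hz
  rw [← (Int.divModEquiv q₁).symm.hasSum_iff] at h
  have h2 := h.prod_fiberwise (fun m => hasSum_fintype _)
  rw [← (Equiv.neg ℤ).hasSum_iff] at h2
  convert h2 using 1
  ext m
  rw [sum_zmod_eq_range, Finset.sum_range]
  simp only [Function.comp, Equiv.neg_apply, Int.divModEquiv_symm_apply]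
  refine Finset.sum_congr rfl fun u _ => ?_
  rw [ZMod.val_cast_of_lt u.2]
  congr 2
  · push_cast; simp
  · congr 1; ring

theorem gsum_eq (h₁ : 1 < q₁) (h₁' : 0 < q₁) (h₂ : 1 < q₂) [NeZero q₁] [NeZero q₂]
    (χ₁ : DirichletCharacter ℂ q₁) (χ₂ : DirichletCharacter ℂ q₂)
    (hχ₂ : χ₂.IsPrimitive)
    (hev₁ : χ₁ (-1) = 1) (hev₂ : χ₂ (-1) = 1) (z : ℂ) (hz : 0 < z.im) :
    gsum h₁' χ₁ χ₂ z hz =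
      (2 * Real.pi * I) ^ 2 * gaussSum' χ₂ * (2 * dsum χ₁ χ₂ z) := by
  set L := pp q₁ h₁' z hz with hL
  have s1 : HasSum (fun l : L.lattice => ∑ u : ZMod q₁, ∑ v : ZMod q₂, χ₁ u * χ₂ v *
      (1 / (((u.val : ℤ) : ℂ) * z + ((v.val : ℤ) : ℂ) / q₂ - l) ^ 2 - 1 / (l : ℂ) ^ 2))
      (gsum h₁' χ₁ χ₂ z hz) :=
    hasSum_sum fun u _ => hasSum_sum fun v _ => (L.hasSum_weierstrassP _).mul_left _
  have s2 : HasSum (fun l : L.lattice => ∑ u : ZMod q₁, ∑ v : ZMod q₂, χ₁ u * χ₂ v *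
      (1 / (((u.val : ℤ) : ℂ) * z + ((v.val : ℤ) : ℂ) / q₂ - l) ^ 2))
      (gsum h₁' χ₁ χ₂ z hz) := by
    convert s1 using 1
    ext l
    refine Finset.sum_congr rfl fun u _ => ?_
    simp_rw [mul_sub]
    rw [Finset.sum_sub_distrib, ← Finset.sum_mul, ← Finset.mul_sum, char_sum h₂ χ₂ hχ₂]
    simp
  rw [← ((Equiv.prodComm ℤ ℤ).trans L.latticeEquivProd.symm.toEquiv).hasSum_iff] at s2
  have s3 := s2.prod_fiberwise (g := fun m : ℤ => (2 * Real.pi * I) ^ 2 * gaussSum' χ₂ *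
    ∑ u : ZMod q₁, χ₁ u * bsum χ₂ z ((u.val : ℤ) - m * q₁).natAbs) ?_
  · exact s3.unique ((hasSum_int' h₁ χ₁ χ₂ hev₁ hz).mul_left _)
  · intro m
    rw [Finset.mul_sum]
    refine hasSum_sum fun u _ => ?_
    by_cases hu : u = 0
    · subst hu
      simp only [char_zero h₁, zero_mul, mul_zero, Finset.sum_const_zero]
      exact hasSum_zero
    · have hl : (u.val : ℤ) - m * q₁ ≠ 0 := by
        intro h0
        apply hu
        have := congrArg (Int.cast : ℤ → ZMod q₁) h0
        simpa using this
      have hl' := Int.natAbs_pos.2 hl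
      rw [show (2 * Real.pi * I) ^ 2 * gaussSum' χ₂ * (χ₁ u *
        bsum χ₂ z ((u.val : ℤ) - m * q₁).natAbs) = χ₁ u * (2 * Real.pi * I) ^ 2 *
          (gaussSum' χ₂ * bsum χ₂ z ((u.val : ℤ) - m * q₁).natAbs) by ring,
        ← bsum_eq χ₂ hχ₂ hev₂ hz hl' ((u.val : ℤ) - m * q₁).sign
          (by rcases lt_or_gt_of_ne hl with h | h
              · right; exact Int.sign_eq_neg_one_of_neg h
              · left; exact Int.sign_eq_one_of_pos h), Finset.mul_sum]
      refine hasSum_sum fun v _ => ?_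
      have := (inner_hasSum hz _ hl v.val q₂).mul_left (χ₁ u * χ₂ v)
      have e0 : χ₁ u * (2 * Real.pi * I) ^ 2 * (χ₂ v * ∑' k : ℕ+, (k : ℂ) *
          eC ((k : ℂ) * (((((u.val : ℤ) - m * q₁).natAbs : ℕ) : ℂ) * z +
            ((((u.val : ℤ) - m * q₁).sign : ℤ) : ℂ) * (((v.val : ℤ) : ℂ) / q₂)))) =
          χ₁ u * χ₂ v * ((2 * Real.pi * I) ^ 2 * ∑' k : ℕ+, (k : ℂ) *
          eC ((k : ℂ) * (((((u.val : ℤ) - m * q₁).natAbs : ℕ) : ℂ) * z +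
            ((((u.val : ℤ) - m * q₁).sign : ℤ) : ℂ) * (((v.val : ℤ) : ℂ) / q₂)))) := by ring
      rw [e0]
      refine Eq.mp (congrArg (fun f => HasSum f _) ?_) this
      · symm
        ext s
        congr 3
        have e : (((L.latticeEquivProd.symm (s, m)) : L.lattice) : ℂ) = s + m * (q₁ * z) := by
          rw [PeriodPair.latticeEquiv_symm_apply]
          simp [hL, pp]
        change _ - (((L.latticeEquivProd.symm (s, m)) : L.lattice) : ℂ) = _
        rw [e]
        push_cast
        ring

end qexp


section limit
variable {q₁ q₂ : ℕ}

lemma odd_moment {q : ℕ} [NeZero q] (ψ : ZMod q → ℂ) (h0 : ψ 0 = 0) (hn : ∀ v, ψ (-v) = ψ v)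
    (hs : ∑ v, ψ v = 0) : ∑ v : ZMod q, ψ v * (v.val : ℂ) = 0 := by
  have h1 : ∑ v : ZMod q, ψ v * (v.val : ℂ) = ∑ v : ZMod q, ψ (-v) * ((-v).val : ℂ) :=
    (Equiv.sum_comp (Equiv.neg (ZMod q)) (fun v : ZMod q => ψ v * (v.val : ℂ))).symm
  have h2 : ∑ v : ZMod q, ψ (-v) * ((-v).val : ℂ) =
      (q : ℂ) * ∑ v, ψ v - ∑ v : ZMod q, ψ v * (v.val : ℂ) := by
    rw [Finset.mul_sum, ← Finset.sum_sub_distrib]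
    refine Finset.sum_congr rfl fun v _ => ?_
    rw [hn]
    by_cases hv : v = 0
    · subst hv; simp [h0]
    · have : NeZero v := ⟨hv⟩
      rw [ZMod.val_neg_of_ne_zero, Nat.cast_sub (ZMod.val_lt v).le]
      ring
  rw [h2, hs, mul_zero, zero_sub] at h1
  exact self_eq_neg.1 h1

/-- The power series of an even character. -/
lemma even_poly {q : ℕ} [NeZero q] (ψ : ZMod q → ℂ) (h0 : ψ 0 = 0) (hn : ∀ v, ψ (-v) = ψ v)
    (hs : ∑ v, ψ v = 0) :
    ∃ Q : Polynomial ℂ, ∀ x : ℂ, ∑ v ∈ Finset.range q, ψ v * x ^ v = (1 - x) ^ 2 * Q.eval x := by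
  classical
  set P : Polynomial ℂ := ∑ v ∈ Finset.range q, Polynomial.C (ψ v) * Polynomial.X ^ v with hP
  have e : ∀ x : ℂ, P.eval x = ∑ v ∈ Finset.range q, ψ v * x ^ v := by
    intro x
    simp [hP, Polynomial.eval_finsetSum]
  have r1 : P.IsRoot 1 := by
    rw [Polynomial.IsRoot, e]
    simp only [one_pow, mul_one]
    rw [← sum_zmod_eq_range]; exact hs
  obtain ⟨P1, hP1⟩ := Polynomial.dvd_iff_isRoot.2 r1
  have r2 : P.derivative.eval 1 = 0 := by
    have := odd_moment ψ h0 hn hs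
    rw [sum_zmod_eq_range (fun v : ZMod q => ψ v * (v.val : ℂ))] at this
    rw [hP, ← this]
    simp only [Polynomial.derivative_sum, Polynomial.eval_finsetSum]
    refine Finset.sum_congr rfl fun v hv => ?_
    rw [ZMod.val_cast_of_lt (Finset.mem_range.1 hv)]
    simp [Polynomial.derivative_X_pow]
  have r3 : P1.IsRoot 1 := by
    rw [hP1] at r2
    simpa [Polynomial.derivative_mul] using r2
  obtain ⟨Q, hQ⟩ := Polynomial.dvd_iff_isRoot.2 r3
  refine ⟨Q, fun x => ?_⟩
  rw [← e, hP1, hQ]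
  simp
  ring

lemma bdd_partial {q : ℕ} [NeZero q] (ψ : ZMod q → ℂ) (h0 : ψ 0 = 0) (hb : ∀ v, ‖ψ v‖ ≤ 1)
    (hs : ∑ v, ψ v = 0) (n : ℕ) : ‖∑ l ∈ Finset.range n, ψ ((l + 1 : ℕ) : ZMod q)‖ ≤ q := by
  set F : ℕ → ℂ := fun n => ∑ l ∈ Finset.range n, ψ (l : ZMod q) with hF
  have hper : Function.Periodic F q := by
    intro n
    simp only [hF]
    rw [add_comm, Finset.sum_range_add, ← sum_zmod_eq_range, hs, zero_add]
    simp
  have h1 : ∑ l ∈ Finset.range n, ψ ((l + 1 : ℕ) : ZMod q) = F (n + 1) := by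
    simp only [hF]
    rw [Finset.sum_range_succ']
    simp [h0]
  rw [h1, ← hper.map_mod_nat]
  have h2 : ‖F ((n + 1) % q)‖ ≤ ((n + 1) % q : ℕ) := by
    refine (norm_sum_le _ _).trans ?_
    refine (Finset.sum_le_sum (fun i _ => hb _)).trans ?_
    simp
  refine h2.trans ?_
  exact_mod_cast (Nat.mod_lt _ (Nat.pos_of_ne_zero (NeZero.ne q))).le

lemma abel_sum (c a : ℕ → ℂ) (n : ℕ) :
    ∑ l ∈ Finset.range n, c l * a l = (∑ l ∈ Finset.range n, c l) * a n +
      ∑ l ∈ Finset.range n, (∑ j ∈ Finset.range (l + 1), c j) * (a l - a (l + 1)) := by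
  induction n with
  | zero => simp
  | succ n ih =>
    rw [Finset.sum_range_succ, ih, Finset.sum_range_succ (fun l => _ * (a l - a (l + 1)))]
    rw [Finset.sum_range_succ c n]
    ring

lemma abel_bound (c a : ℕ → ℂ) (B M V : ℝ) (hB : 0 ≤ B)
    (hc : ∀ n, ‖∑ l ∈ Finset.range n, c l‖ ≤ B) (ha : ∀ n, ‖a n‖ ≤ M)
    (hV : ∀ n, ∑ l ∈ Finset.range n, ‖a l - a (l + 1)‖ ≤ V) (n : ℕ) :
    ‖∑ l ∈ Finset.range n, c l * a l‖ ≤ B * (M + V) := by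
  rw [abel_sum, mul_add]
  refine (norm_add_le _ _).trans (add_le_add ?_ ?_)
  · rw [norm_mul]; exact mul_le_mul (hc n) (ha n) (norm_nonneg _) hB
  · refine (norm_sum_le _ _).trans ?_
    refine le_trans ?_ (mul_le_mul_of_nonneg_left (hV n) hB)
    rw [Finset.mul_sum]
    refine Finset.sum_le_sum fun l _ => ?_
    rw [norm_mul]
    exact mul_le_mul_of_nonneg_right (hc _) (norm_nonneg _)

/-- averages of powers -/
noncomputable def avgPow (x : ℝ) (l : ℕ) : ℝ := (∑ i ∈ Finset.range (l + 1), x ^ i) / (l + 1)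

lemma avgPow_nonneg {x : ℝ} (h0 : 0 ≤ x) (l : ℕ) : 0 ≤ avgPow x l := by
  unfold avgPow; positivity

lemma avgPow_le_one {x : ℝ} (h0 : 0 ≤ x) (h1 : x ≤ 1) (l : ℕ) : avgPow x l ≤ 1 := by
  unfold avgPow
  rw [div_le_one (by positivity)]
  refine (Finset.sum_le_sum (fun i _ => pow_le_one₀ h0 h1)).trans ?_
  simp

lemma avgPow_anti {x : ℝ} (h0 : 0 ≤ x) (h1 : x ≤ 1) (l : ℕ) : avgPow x (l + 1) ≤ avgPow x l := by
  unfold avgPow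
  rw [div_le_div_iff₀ (by positivity) (by positivity), Finset.sum_range_succ _ (l + 1)]
  have : (l + 1 : ℝ) * x ^ (l + 1) ≤ ∑ i ∈ Finset.range (l + 1), x ^ i := by
    have : ∑ i ∈ Finset.range (l + 1), x ^ (l + 1) ≤ ∑ i ∈ Finset.range (l + 1), x ^ i :=
      Finset.sum_le_sum fun i hi =>
        pow_le_pow_of_le_one h0 h1 (Finset.mem_range.1 hi).le
    simpa using this
  push_cast
  nlinarith

lemma avgPow_mul (x : ℝ) (l : ℕ) : (1 - x) * avgPow x l = (1 - x ^ (l + 1)) / (l + 1) := by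
  unfold avgPow
  rw [← mul_div_assoc, mul_neg_geom_sum]

lemma char_bound (R : ℝ → ℂ) (K M : ℝ) (hK : 0 ≤ K) (hM : 0 ≤ M)
    (hRM : ∀ u ∈ Set.Icc (0 : ℝ) 1, ‖R u‖ ≤ M)
    (hRK : ∀ u ∈ Set.Icc (0 : ℝ) 1, ∀ v ∈ Set.Icc (0 : ℝ) 1, ‖R u - R v‖ ≤ K * |u - v|)
    (c : ℕ → ℂ) (B : ℝ) (hB : 0 ≤ B) (hc : ∀ n, ‖∑ l ∈ Finset.range n, c l‖ ≤ B)
    {x : ℝ} (h0 : 0 ≤ x) (h1 : x ≤ 1) (n : ℕ) :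
    ‖∑ l ∈ Finset.range n, c l * (R (x ^ (l + 1)) * avgPow x l)‖ ≤ B * (M + (K + M)) := by
  have hmem : ∀ l : ℕ, x ^ l ∈ Set.Icc (0 : ℝ) 1 := fun l =>
    ⟨pow_nonneg h0 _, pow_le_one₀ h0 h1⟩
  have hA0 := avgPow_nonneg h0
  have hA1 := avgPow_le_one h0 h1
  refine abel_bound c (fun l => R (x ^ (l + 1)) * avgPow x l) B M (K + M) hB hc ?_ ?_ n
  · intro n
    rw [norm_mul, Complex.norm_real, Real.norm_of_nonneg (hA0 n)]
    calc _ ≤ M * 1 := mul_le_mul (hRM _ (hmem _)) (hA1 n) (hA0 n) hM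
      _ = M := mul_one M
  · intro n
    have key : ∀ l : ℕ, ‖R (x ^ (l + 1)) * avgPow x l - R (x ^ (l + 1 + 1)) * avgPow x (l + 1)‖ ≤
        K * (x ^ (l + 1) - x ^ (l + 1 + 1)) + M * (avgPow x l - avgPow x (l + 1)) := by
      intro l
      have e : R (x ^ (l + 1)) * avgPow x l - R (x ^ (l + 1 + 1)) * avgPow x (l + 1) =
        (R (x ^ (l + 1)) - R (x ^ (l + 1 + 1))) * avgPow x l +
          R (x ^ (l + 1 + 1)) * ((avgPow x l - avgPow x (l + 1) : ℝ) : ℂ) := by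
        push_cast; ring
      rw [e]
      refine (norm_add_le _ _).trans (add_le_add ?_ ?_)
      · rw [norm_mul, Complex.norm_real, Real.norm_of_nonneg (hA0 l)]
        have h3 := hRK _ (hmem (l + 1)) _ (hmem (l + 1 + 1))
        have h4 : x ^ (l + 1 + 1) ≤ x ^ (l + 1) := pow_le_pow_of_le_one h0 h1 (by omega)
        rw [abs_of_nonneg (by linarith)] at h3
        calc _ ≤ (K * (x ^ (l + 1) - x ^ (l + 1 + 1))) * 1 :=
              mul_le_mul h3 (hA1 l) (hA0 l) ((norm_nonneg _).trans h3)
          _ = _ := mul_one _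
      · rw [norm_mul, Complex.norm_real, Real.norm_of_nonneg (by linarith [avgPow_anti h0 h1 l])]
        exact mul_le_mul_of_nonneg_right (hRM _ (hmem _)) (by linarith [avgPow_anti h0 h1 l])
    refine (Finset.sum_le_sum fun l _ => key l).trans ?_
    rw [Finset.sum_add_distrib, ← Finset.mul_sum, ← Finset.mul_sum,
      Finset.sum_range_sub' (fun l => x ^ (l + 1)), Finset.sum_range_sub' (fun l => avgPow x l)]
    have h5 := hmem (0 + 1)
    have h6 := hmem (n + 1)
    refine add_le_add ?_ ?_
    · calc _ ≤ K * 1 := mul_le_mul_of_nonneg_left (by linarith [h5.2, h6.1]) hK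
        _ = K := mul_one K
    · calc _ ≤ M * 1 := mul_le_mul_of_nonneg_left (by linarith [hA1 0, hA0 n]) hM
        _ = M := mul_one M

/-- The rational function, with Lipschitz and sup bounds. -/
lemma exists_R {q : ℕ} [NeZero q] (ψ : ZMod q → ℂ) (h0 : ψ 0 = 0) (hn : ∀ v, ψ (-v) = ψ v)
    (hs : ∑ v, ψ v = 0) (hb : ∀ v, ‖ψ v‖ ≤ 1) :
    ∃ (R : ℝ → ℂ) (K M : ℝ), 0 ≤ K ∧ 0 ≤ M ∧ (∀ u ∈ Set.Icc (0 : ℝ) 1, ‖R u‖ ≤ M) ∧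
      (∀ u ∈ Set.Icc (0 : ℝ) 1, ∀ v ∈ Set.Icc (0 : ℝ) 1, ‖R u - R v‖ ≤ K * |u - v|) ∧
      ∀ x : ℝ, 0 < x → x < 1 →
        ∑' k : ℕ+, ψ ((k : ℕ) : ZMod q) * (x : ℂ) ^ (k : ℕ) = (1 - x) * R x := by
  obtain ⟨Q, hQ⟩ := even_poly ψ h0 hn hs
  have hq : 0 < q := Nat.pos_of_ne_zero (NeZero.ne q)
  set S : ℝ → ℝ := fun x => ∑ i ∈ Finset.range q, x ^ i with hS
  have hSpos : ∀ x ∈ Set.Icc (0 : ℝ) 1, 0 < S x := by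
    intro x hx
    obtain ⟨m, rfl⟩ := Nat.exists_eq_succ_of_ne_zero hq.ne'
    simp only [hS, Nat.succ_eq_add_one]
    rw [Finset.sum_range_succ']
    have : 0 ≤ ∑ i ∈ Finset.range m, x ^ (i + 1) :=
      Finset.sum_nonneg fun i _ => pow_nonneg hx.1 _
    simp; linarith
  set R : ℝ → ℂ := fun x => Q.eval (x : ℂ) / ((S x : ℝ) : ℂ) with hR
  have hRd : ContDiffOn ℝ 1 R (Set.Icc 0 1) := by
    have c1 : ContDiff ℝ 1 (fun x : ℝ => Q.eval (x : ℂ)) := by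
      have c0 : ContDiff ℝ 1 (fun x : ℝ => (x : ℂ)) := ofRealCLM.contDiff
      simp only [Polynomial.eval_eq_sum_range]
      exact ContDiff.sum fun i _ => contDiff_const.mul (c0.pow i)
    have c2 : ContDiff ℝ 1 (fun x : ℝ => ((S x : ℝ) : ℂ)) := by
      refine ofRealCLM.contDiff.comp (?_ : ContDiff ℝ 1 S)
      simp only [hS]
      fun_prop
    simp only [hR, div_eq_mul_inv]
    refine c1.contDiffOn.mul (c2.contDiffOn.inv fun x hx => ?_)
    exact_mod_cast (hSpos x hx).ne'
  obtain ⟨K, hK⟩ := hRd.exists_lipschitzOnWith one_ne_zero (convex_Icc 0 1) isCompact_Icc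
  obtain ⟨M, hM⟩ := isCompact_Icc.exists_bound_of_continuousOn hRd.continuousOn
  refine ⟨R, K, M, K.2, (norm_nonneg _).trans (hM 0 (by simp)), hM, ?_, ?_⟩
  · intro u hu v hv
    have := hK.dist_le_mul u hu v hv
    rwa [dist_eq_norm, Real.dist_eq] at this
  · intro x hx0 hx1
    have hxn : ‖(x : ℂ)‖ < 1 := by rw [Complex.norm_real, Real.norm_of_nonneg hx0.le]; exact hx1
    have hsm : Summable (fun k : ℕ => ψ (k : ZMod q) * (x : ℂ) ^ k) := by
      refine Summable.of_norm_bounded (summable_geometric_of_lt_one hx0.le hx1) fun k => ?_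
      rw [norm_mul, norm_pow, Complex.norm_real, Real.norm_of_nonneg hx0.le]
      exact mul_le_of_le_one_left (by positivity) (hb _)
    have hsplit := hsm.sum_add_tsum_nat_add q
    rw [hQ] at hsplit
    have e1 : ∑' k : ℕ, ψ ((k + q : ℕ) : ZMod q) * (x : ℂ) ^ (k + q) =
        (x : ℂ) ^ q * ∑' k : ℕ, ψ (k : ZMod q) * (x : ℂ) ^ k := by
      rw [← tsum_mul_left]
      refine tsum_congr fun k => ?_
      rw [pow_add]; simp; ring
    rw [e1] at hsplit
    have e2 : ∑' k : ℕ+, ψ ((k : ℕ) : ZMod q) * (x : ℂ) ^ (k : ℕ) =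
        ∑' k : ℕ, ψ (k : ZMod q) * (x : ℂ) ^ k := by
      rw [tsum_pnat_eq_tsum_succ (f := fun k : ℕ => ψ (k : ZMod q) * (x : ℂ) ^ k),
        hsm.tsum_eq_zero_add]
      simp [h0]
    rw [e2]
    set H := ∑' k : ℕ, ψ (k : ZMod q) * (x : ℂ) ^ k
    have hSx := hSpos x ⟨hx0.le, hx1.le⟩
    have hgeom : (1 - (x : ℂ)) * ((S x : ℝ) : ℂ) = 1 - (x : ℂ) ^ q := by
      have := mul_neg_geom_sum x q
      rw [← ofReal_one, ← ofReal_sub, ← ofReal_mul, this]; push_cast; rfl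
    have hS0 : ((S x : ℝ) : ℂ) ≠ 0 := by exact_mod_cast hSx.ne'
    have hx' : (1 - (x : ℂ)) ≠ 0 := by
      rw [← ofReal_one, ← ofReal_sub]
      exact_mod_cast (by linarith : (1 - x) ≠ 0)
    simp only [hR]
    rw [← mul_div_assoc, eq_div_iff hS0]
    apply mul_left_cancel₀ hx'
    linear_combination (-1 : ℂ) * hsplit + H * hgeom

end limit


section limit2
variable {q₁ q₂ : ℕ}

lemma eC_Iy (y : ℝ) (k l : ℕ) :
    eC ((k : ℂ) * (l : ℂ) * (I * y)) = (((Real.exp (-(2 * Real.pi * y))) ^ l : ℝ) : ℂ) ^ k := by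
  rw [eC, ofReal_pow, ← pow_mul, ofReal_exp, ← Complex.exp_nat_mul]
  congr 1
  push_cast
  linear_combination (2 * Real.pi * k * l * y : ℂ) * I_mul_I

lemma fE_bound (h₁ : 1 < q₁) (h₂ : 1 < q₂) [NeZero q₁] [NeZero q₂]
    (χ₁ : DirichletCharacter ℂ q₁) (χ₂ : DirichletCharacter ℂ q₂)
    (hχ₁ : χ₁.IsPrimitive) (hχ₂ : χ₂.IsPrimitive) (hev₂ : χ₂ (-1) = 1) :
    ∃ C : ℝ, ∀ y : ℝ, 0 < y →
      ‖fE χ₁ χ₂ (I * y)‖ ≤ (1 - Real.exp (-(2 * Real.pi * y))) * C := by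
  obtain ⟨R, K, M, hK, hM, hRM, hRK, hR⟩ := exists_R (fun v => (starRingEnd ℂ) (χ₂ v))
    (by simp [char_zero h₂]) (fun v => by rw [char_neg χ₂ hev₂])
    (by rw [← map_sum, char_sum h₂ χ₂ hχ₂, map_zero])
    (fun v => by rw [RCLike.norm_conj]; exact norm_char_le _ _)
  refine ⟨q₁ * (M + (K + M)), fun y hy => ?_⟩
  have hy' : 0 < (I * (y : ℂ)).im := by simpa using hy
  set x := Real.exp (-(2 * Real.pi * y)) with hx
  have hx0 : 0 < x := Real.exp_pos _
  have hx1 : x < 1 := exp_lt_one' hy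
  have hs := summable_fTerm χ₁ χ₂ hy'
  have h1 := hs.hasSum.prod_fiberwise (fun l => (hs.prod_factor l).hasSum)
  rw [← fE_eq χ₁ χ₂ hy', ← Equiv.pnatEquivNat.symm.hasSum_iff] at h1
  have h2 : HasSum (fun n : ℕ => (1 - (x : ℂ)) *
      (χ₁ ((n + 1 : ℕ) : ZMod q₁) * (R (x ^ (n + 1)) * avgPow x n))) (fE χ₁ χ₂ (I * y)) := by
    refine Eq.mp (congrArg (fun f => HasSum f _) ?_) h1
    ext n
    simp only [Function.comp, fTerm]
    have e : ((Equiv.pnatEquivNat.symm n : ℕ+) : ℕ) = n + 1 := rfl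
    rw [e]
    have e2 : ∀ k : ℕ+, χ₁ ((n + 1 : ℕ) : ZMod q₁) * (starRingEnd ℂ) (χ₂ ((k : ℕ) : ZMod q₂)) /
        ((n + 1 : ℕ) : ℂ) * eC (((k : ℕ) : ℂ) * ((n + 1 : ℕ) : ℂ) * (I * y)) =
        χ₁ ((n + 1 : ℕ) : ZMod q₁) / ((n + 1 : ℕ) : ℂ) *
          ((starRingEnd ℂ) (χ₂ ((k : ℕ) : ZMod q₂)) * ((x ^ (n + 1) : ℝ) : ℂ) ^ (k : ℕ)) := by
      intro k
      rw [eC_Iy]; ring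
    rw [tsum_congr e2, tsum_mul_left, hR _ (pow_pos hx0 _) (pow_lt_one₀ hx0.le hx1 (by omega))]
    have e3 := congrArg (fun t : ℝ => (t : ℂ)) (avgPow_mul x n)
    push_cast at e3 ⊢
    linear_combination (-χ₁ (n + 1) * R (x ^ (n + 1))) * e3
  have h3 := h2.tendsto_sum_nat.norm
  refine le_of_tendsto' h3 fun n => ?_
  rw [← Finset.mul_sum, norm_mul]
  have h4 : ‖(1 - (x : ℂ))‖ = 1 - x := by
    rw [← ofReal_one, ← ofReal_sub, Complex.norm_real, Real.norm_of_nonneg (by linarith)]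
  rw [h4]
  refine mul_le_mul_of_nonneg_left ?_ (by linarith)
  exact char_bound R K M hK hM hRM hRK (fun l => χ₁ ((l + 1 : ℕ) : ZMod q₁)) q₁ (by positivity)
    (fun n => bdd_partial (fun v => χ₁ v) (char_zero h₁ χ₁) (norm_char_le χ₁)
      (char_sum h₁ χ₁ hχ₁) n) hx0.le hx1.le n

open Filter Topology in
lemma fE_tendsto_zero (h₁ : 1 < q₁) (h₂ : 1 < q₂) [NeZero q₁] [NeZero q₂]
    (χ₁ : DirichletCharacter ℂ q₁) (χ₂ : DirichletCharacter ℂ q₂)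
    (hχ₁ : χ₁.IsPrimitive) (hχ₂ : χ₂.IsPrimitive) (hev₂ : χ₂ (-1) = 1) :
    Tendsto (fun y : ℝ => fE χ₁ χ₂ (I * y)) (𝓝[>] 0) (𝓝 0) := by
  obtain ⟨C, hC⟩ := fE_bound h₁ h₂ χ₁ χ₂ hχ₁ hχ₂ hev₂
  have h : Tendsto (fun y : ℝ => (1 - Real.exp (-(2 * Real.pi * y))) * C) (𝓝[>] 0) (𝓝 0) := by
    have : Continuous (fun y : ℝ => (1 - Real.exp (-(2 * Real.pi * y))) * C) := by fun_prop
    have h := this.tendsto 0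
    simp only [mul_zero, neg_zero, Real.exp_zero, sub_self, zero_mul] at h
    exact h.mono_left nhdsWithin_le_nhds
  refine squeeze_zero_norm' ?_ h
  filter_upwards [self_mem_nhdsWithin] with y hy using hC y hy

open Filter Topology in
lemma fE_tendsto_top (χ₁ : DirichletCharacter ℂ q₁) (χ₂ : DirichletCharacter ℂ q₂) :
    Tendsto (fun y : ℝ => fE χ₁ χ₂ (I * y)) atTop (𝓝 0) := by
  have h := tendsto_tsum_of_dominated_convergence (𝓕 := atTop) (α := ℝ) (β := ℕ+ × ℕ+) (G := ℂ)
    (f := fun y p => fTerm χ₁ χ₂ p (I * y)) (g := fun _ => 0)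
    (summable_bound (Real.exp_pos _) (exp_lt_one' one_pos)) ?_ ?_
  · rw [tsum_zero] at h
    refine h.congr' ?_
    filter_upwards [eventually_gt_atTop 0] with y hy
    rw [fE_eq]
    simpa using hy
  · intro p
    have h1 : Tendsto (fun y : ℝ => (p.2 : ℝ) *
        Real.exp (-(2 * Real.pi * y)) ^ ((p.2 : ℕ) * (p.1 : ℕ))) atTop (𝓝 0) := by
      have h2 : Tendsto (fun y : ℝ => Real.exp (-(2 * Real.pi * y))) atTop (𝓝 0) :=
        Real.tendsto_exp_neg_atTop_nhds_zero.comp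
          (tendsto_id.const_mul_atTop (by positivity : (0 : ℝ) < 2 * Real.pi))
      have h3 := (h2.pow ((p.2 : ℕ) * (p.1 : ℕ))).const_mul (p.2 : ℝ)
      rwa [zero_pow (Nat.mul_ne_zero p.2.ne_zero p.1.ne_zero), mul_zero] at h3
    refine squeeze_zero_norm (fun y => ?_) h1
    exact norm_fTerm_le χ₁ χ₂ p (by simp)
  · filter_upwards [eventually_ge_atTop 1] with y hy p
    exact norm_fTerm_le χ₁ χ₂ p (by simpa using hy)

end limit2


section assembly
variable {q₁ q₂ : ℕ}

lemma const_of_deriv (F : ℂ → ℂ) (h : ∀ z : ℂ, 0 < z.im → HasDerivAt F 0 z) (z w : ℂ)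
    (hz : 0 < z.im) (hw : 0 < w.im) : F z = F w := by
  have ho : IsOpen {w : ℂ | 0 < w.im} := isOpen_lt continuous_const Complex.continuous_im
  have hp : IsPreconnected {w : ℂ | 0 < w.im} := (convex_halfSpace_im_gt 0).isPreconnected
  exact ho.is_const_of_deriv_eq_zero hp
    (fun z hz => (h z hz).differentiableAt.differentiableWithinAt)
    (fun z hz => (h z hz).deriv) hz hw

lemma conj_char_of_mul {q : ℕ} (χ : DirichletCharacter ℂ q) (a d : ZMod q) (h : a * d = 1) :
    (starRingEnd ℂ) (χ d) = χ a := by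
  rw [conj_char, MulChar.inv_apply]
  congr 1
  exact Ring.inverse_unit (⟨d, a, by rw [mul_comm]; exact h, h⟩ : (ZMod q)ˣ)

lemma two_pi_ne : (2 * Real.pi * I : ℂ) ≠ 0 := two_pi_I_ne_zero

lemma mobius_const (h₁ : 1 < q₁) (h₂ : 1 < q₂) [NeZero q₁] [NeZero q₂]
    (χ₁ : DirichletCharacter ℂ q₁) (χ₂ : DirichletCharacter ℂ q₂) (hχ₂ : χ₂.IsPrimitive)
    (hev₁ : χ₁ (-1) = 1) (hev₂ : χ₂ (-1) = 1) (a b c d : ℤ)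
    (hdet : a * d - b * (c * (q₁ * q₂ : ℕ)) = 1) (z w : ℂ) (hz : 0 < z.im) (hw : 0 < w.im) :
    fE χ₁ χ₂ (((a : ℂ) * z + (b : ℂ)) / (((c * (q₁ * q₂ : ℕ) : ℤ) : ℂ) * z + (d : ℂ))) -
        χ₁ ((d : ℤ) : ZMod q₁) * (starRingEnd ℂ) (χ₂ ((d : ℤ) : ZMod q₂)) * fE χ₁ χ₂ z =
    fE χ₁ χ₂ (((a : ℂ) * w + (b : ℂ)) / (((c * (q₁ * q₂ : ℕ) : ℤ) : ℂ) * w + (d : ℂ))) -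
        χ₁ ((d : ℤ) : ZMod q₁) * (starRingEnd ℂ) (χ₂ ((d : ℤ) : ZMod q₂)) * fE χ₁ χ₂ w := by
  refine const_of_deriv (fun z => fE χ₁ χ₂ (((a : ℂ) * z + (b : ℂ)) /
    (((c * (q₁ * q₂ : ℕ) : ℤ) : ℂ) * z + (d : ℂ))) -
        χ₁ ((d : ℤ) : ZMod q₁) * (starRingEnd ℂ) (χ₂ ((d : ℤ) : ZMod q₂)) * fE χ₁ χ₂ z)
      ?_ z w hz hw
  intro z hz
  have hz' := im_mobius a b (c * (q₁ * q₂ : ℕ)) d hdet z hz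
  have hj : ((c * (q₁ * q₂ : ℕ) : ℤ) : ℂ) * z + d ≠ 0 := by
    apply denom_ne_zero' _ _ _ _ hz
    by_contra! h
    rw [h.1, h.2] at hdet
    simp at hdet
  have hg := gsum_mobius (by omega) (by omega) χ₁ χ₂ a b c d hdet z hz _ hz' rfl
  rw [gsum_eq h₁ _ h₂ χ₁ χ₂ hχ₂ hev₁ hev₂, gsum_eq h₁ _ h₂ χ₁ χ₂ hχ₂ hev₁ hev₂] at hg
  have ht := gauss_ne_zero χ₂ hχ₂ hev₂
  have hdetC : (a : ℂ) * d - b * ((c * (q₁ * q₂ : ℕ) : ℤ) : ℂ) = 1 := by exact_mod_cast hdet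
  generalize ((c * (q₁ * q₂ : ℕ) : ℤ) : ℂ) = C at *
  generalize χ₁ ((d : ℤ) : ZMod q₁) * (starRingEnd ℂ) (χ₂ ((d : ℤ) : ZMod q₂)) = ψ at *
  have hg2 : dsum χ₁ χ₂ ((a * z + b) / (C * z + d)) = (C * z + d) ^ 2 * (ψ * dsum χ₁ χ₂ z) := by
    have h0 : (2 * Real.pi * I : ℂ) ^ 2 * gaussSum' χ₂ * 2 ≠ 0 :=
      mul_ne_zero (mul_ne_zero (pow_ne_zero _ two_pi_ne) ht) two_ne_zero
    apply mul_left_cancel₀ h0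
    linear_combination hg
  have d1 : HasDerivAt (fun z : ℂ => ((a : ℂ) * z + b) / (C * z + d)) (1 / (C * z + d) ^ 2) z := by
    have n1 : HasDerivAt (fun z : ℂ => (a : ℂ) * z + b) a z := by
      simpa using ((hasDerivAt_id z).const_mul (a : ℂ)).add_const (b : ℂ)
    have n2 : HasDerivAt (fun z : ℂ => C * z + d) C z := by
      simpa using ((hasDerivAt_id z).const_mul C).add_const (d : ℂ)
    refine (n1.div n2 hj).congr_deriv ?_
    congr 1
    linear_combination hdetC
  have d2 := (hasDerivAt_fE χ₁ χ₂ hz').comp z d1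
  have d3 := d2.sub ((hasDerivAt_fE χ₁ χ₂ hz).const_mul ψ)
  refine d3.congr_deriv ?_
  rw [hg2]
  field_simp
  ring

lemma fricke_eq (h₁ : 1 < q₁) (h₂ : 1 < q₂) [NeZero q₁] [NeZero q₂]
    (χ₁ : DirichletCharacter ℂ q₁) (χ₂ : DirichletCharacter ℂ q₂)
    (hχ₁ : χ₁.IsPrimitive) (hχ₂ : χ₂.IsPrimitive)
    (hev₁ : χ₁ (-1) = 1) (hev₂ : χ₂ (-1) = 1) (z : ℂ) (hz : 0 < z.im) :
    gaussSum' (χ₁.ringHomComp (starRingEnd ℂ)) * fE χ₁ χ₂ (-1 / (((q₁ * q₂ : ℕ) : ℂ) * z)) =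
    gaussSum' (χ₂.ringHomComp (starRingEnd ℂ)) * fE χ₂ χ₁ z := by
  have hN : 0 < q₁ * q₂ := Nat.mul_pos (by omega) (by omega)
  have hq₁ : (q₁ : ℂ) ≠ 0 := by exact_mod_cast (by omega : q₁ ≠ 0)
  have hq₂ : (q₂ : ℂ) ≠ 0 := by exact_mod_cast (by omega : q₂ ≠ 0)
  set F : ℂ → ℂ := fun z => gaussSum' (χ₁.ringHomComp (starRingEnd ℂ)) *
    fE χ₁ χ₂ (-1 / (((q₁ * q₂ : ℕ) : ℂ) * z)) -
    gaussSum' (χ₂.ringHomComp (starRingEnd ℂ)) * fE χ₂ χ₁ z with hF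
  have hconst := const_of_deriv F ?_
  · have t1 : Filter.Tendsto (fun y : ℝ => F (I * y)) Filter.atTop (nhds 0) := by
      have s1 : Filter.Tendsto (fun y : ℝ => 1 / (((q₁ * q₂ : ℕ) : ℝ) * y)) Filter.atTop
          (nhdsWithin 0 (Set.Ioi 0)) := by
        have hN' : (0 : ℝ) < ((q₁ * q₂ : ℕ) : ℝ) := by exact_mod_cast hN
        have := tendsto_inv_atTop_nhdsGT_zero.comp
          (Filter.tendsto_id.const_mul_atTop hN')
        refine this.congr fun y => ?_
        simp
      have s2 := (fE_tendsto_zero h₁ h₂ χ₁ χ₂ hχ₁ hχ₂ hev₂).comp s1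
      have s3 := (s2.const_mul (gaussSum' (χ₁.ringHomComp (starRingEnd ℂ)))).sub
        ((fE_tendsto_top χ₂ χ₁).const_mul (gaussSum' (χ₂.ringHomComp (starRingEnd ℂ))))
      simp only [mul_zero, sub_zero] at s3
      refine s3.congr fun y => ?_
      simp only [hF, Function.comp]
      congr 3
      push_cast
      rw [mul_left_comm _ I, ← I_mul_I, mul_div_mul_left _ _ I_ne_zero, mul_one_div]
    have t2 : Filter.Tendsto (fun y : ℝ => F (I * y)) Filter.atTop (nhds (F z)) := by
      refine tendsto_const_nhds.congr' ?_
      filter_upwards [Filter.eventually_gt_atTop 0] with y hy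
      exact hconst _ _ hz (by simpa using hy)
    exact sub_eq_zero.1 (tendsto_nhds_unique t2 t1)
  · intro z hz
    have hz0 : z ≠ 0 := by rintro rfl; simp at hz
    have hz' := im_fricke hN z hz
    have hg := gsum_fricke (by omega) (by omega) χ₁ χ₂ hev₁ z hz _ hz' rfl
    rw [gsum_eq h₁ _ h₂ χ₁ χ₂ hχ₂ hev₁ hev₂, gsum_eq h₂ _ h₁ χ₂ χ₁ hχ₁ hev₂ hev₁] at hg
    have g1 := gauss_mul χ₁ hχ₁ hev₁
    have g2 := gauss_mul χ₂ hχ₂ hev₂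
    have ht₁ := gauss_ne_zero χ₁ hχ₁ hev₁
    have ht₂ := gauss_ne_zero χ₂ hχ₂ hev₂
    have hN0 : ((q₁ * q₂ : ℕ) : ℂ) ≠ 0 := by exact_mod_cast hN.ne'
    have d1 : HasDerivAt (fun z : ℂ => -1 / (((q₁ * q₂ : ℕ) : ℂ) * z))
        (1 / (((q₁ * q₂ : ℕ) : ℂ) * z ^ 2)) z := by
      have n2 : HasDerivAt (fun z : ℂ => ((q₁ * q₂ : ℕ) : ℂ) * z) ((q₁ * q₂ : ℕ) : ℂ) z := by
        simpa using ((hasDerivAt_id z).const_mul (((q₁ * q₂ : ℕ) : ℂ)))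
      refine ((hasDerivAt_const z (-1 : ℂ)).div n2 (mul_ne_zero hN0 hz0)).congr_deriv ?_
      field_simp
      simp
    have d2 := (hasDerivAt_fE χ₁ χ₂ hz').comp z d1
    have d3 := (d2.const_mul (gaussSum' (χ₁.ringHomComp (starRingEnd ℂ)))).sub
      ((hasDerivAt_fE χ₂ χ₁ hz).const_mul (gaussSum' (χ₂.ringHomComp (starRingEnd ℂ))))
    refine d3.congr_deriv ?_
    have hg2 : gaussSum' χ₂ * dsum χ₁ χ₂ (-1 / (((q₁ * q₂ : ℕ) : ℂ) * z)) =
        (q₂ * z) ^ 2 * (gaussSum' χ₁ * dsum χ₂ χ₁ z) := by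
      have h0 : (2 * Real.pi * I : ℂ) ^ 2 * 2 ≠ 0 :=
        mul_ne_zero (pow_ne_zero _ two_pi_ne) two_ne_zero
      apply mul_left_cancel₀ h0
      linear_combination hg
    generalize dsum χ₁ χ₂ (-1 / (((q₁ * q₂ : ℕ) : ℂ) * z)) = D1 at *
    generalize dsum χ₂ χ₁ z = D2 at *
    generalize gaussSum' (χ₁.ringHomComp (starRingEnd ℂ)) = T1 at *
    generalize gaussSum' (χ₂.ringHomComp (starRingEnd ℂ)) = T2 at *
    generalize gaussSum' χ₁ = S1 at *
    generalize gaussSum' χ₂ = S2 at *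
    have key : T1 * D1 = T2 * D2 * (q₁ * q₂ * z ^ 2) := by
      apply mul_left_cancel₀ ht₂
      linear_combination T1 * hg2 + (q₂ * z) ^ 2 * D2 * g1 - q₁ * q₂ * z ^ 2 * D2 * g2
    push_cast
    field_simp
    linear_combination (2 * Real.pi * I : ℂ) * key

end assembly

theorem reciprocity_even
    {q₁ q₂ : ℕ} (hq₁ : 1 < q₁) (hq₂ : 1 < q₂)
    (χ₁ : DirichletCharacter ℂ q₁) (χ₂ : DirichletCharacter ℂ q₂)
    (hχ₁ : χ₁.IsPrimitive) (hχ₂ : χ₂.IsPrimitive)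
    (hχ₁even : χ₁ (-1) = 1) (hχ₂even : χ₂ (-1) = 1)
    (a b c d : ℤ) (hdet : a * d - b * (c * (q₁ * q₂ : ℕ)) = 1)
    (z w : ℂ) (hz : 0 < z.im) (hw : 0 < w.im) :
    gaussSum' (χ₁.ringHomComp (starRingEnd ℂ)) / (Real.pi * Complex.I) *
      (fE χ₁ χ₂ (((a : ℂ) * z + (b : ℂ)) / (((c * (q₁ * q₂ : ℕ) : ℤ) : ℂ) * z + (d : ℂ))) -
        χ₁ ((d : ℤ) : ZMod q₁) * (starRingEnd ℂ) (χ₂ ((d : ℤ) : ZMod q₂)) * fE χ₁ χ₂ z) =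
    gaussSum' (χ₂.ringHomComp (starRingEnd ℂ)) / (Real.pi * Complex.I) *
      (fE χ₂ χ₁ (((d : ℂ) * w + ((-c : ℤ) : ℂ)) / (((-b * (q₁ * q₂ : ℕ) : ℤ) : ℂ) * w + (a : ℂ))) -
        χ₂ ((a : ℤ) : ZMod q₂) * (starRingEnd ℂ) (χ₁ ((a : ℤ) : ZMod q₁)) * fE χ₂ χ₁ w) := by
  have : NeZero q₁ := ⟨by omega⟩
  have : NeZero q₂ := ⟨by omega⟩
  have hN : 0 < q₁ * q₂ := Nat.mul_pos (by omega) (by omega)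
  have hN0 : ((q₁ * q₂ : ℕ) : ℂ) ≠ 0 := by exact_mod_cast hN.ne'
  have hw0 : w ≠ 0 := by rintro rfl; simp at hw
  have had₁ : (a : ZMod q₁) * (d : ZMod q₁) = 1 := by
    have := congrArg (Int.cast : ℤ → ZMod q₁) hdet
    simpa using this
  have had₂ : (a : ZMod q₂) * (d : ZMod q₂) = 1 := by
    have := congrArg (Int.cast : ℤ → ZMod q₂) hdet
    simpa using this
  have c1 := conj_char_of_mul χ₁ d a (by rw [mul_comm]; exact had₁)
  have c2 := conj_char_of_mul χ₂ a d had₂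
  have hdet' : d * a - (-c) * (-b * (q₁ * q₂ : ℕ)) = 1 := by linarith
  have hw2 := im_mobius d (-c) (-b * (q₁ * q₂ : ℕ)) a hdet' w hw
  have hj : ((-b * (q₁ * q₂ : ℕ) : ℤ) : ℂ) * w + a ≠ 0 := by
    apply denom_ne_zero' _ _ _ _ hw
    by_contra! h
    rw [h.1, h.2] at hdet'
    simp at hdet'
  have hn : (d : ℂ) * w + ((-c : ℤ) : ℂ) ≠ 0 := by
    apply denom_ne_zero' _ _ _ _ hw
    by_contra! h
    rw [h.1, h.2] at hdet'
    simp at hdet'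
  rw [mobius_const hq₁ hq₂ χ₁ χ₂ hχ₂ hχ₁even hχ₂even a b c d hdet z _ hz (im_fricke hN w hw)]
  have f1 := fricke_eq hq₁ hq₂ χ₁ χ₂ hχ₁ hχ₂ hχ₁even hχ₂even w hw
  have f2 := fricke_eq hq₁ hq₂ χ₁ χ₂ hχ₁ hχ₂ hχ₁even hχ₂even _ hw2
  have hzz : ((a : ℂ) * (-1 / (((q₁ * q₂ : ℕ) : ℂ) * w)) + (b : ℂ)) /
      (((c * (q₁ * q₂ : ℕ) : ℤ) : ℂ) * (-1 / (((q₁ * q₂ : ℕ) : ℂ) * w)) + (d : ℂ)) =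
      -1 / (((q₁ * q₂ : ℕ) : ℂ) * (((d : ℂ) * w + ((-c : ℤ) : ℂ)) /
        (((-b * (q₁ * q₂ : ℕ) : ℤ) : ℂ) * w + (a : ℂ)))) := by
    push_cast at hj hn hN0 ⊢
    generalize (q₁ : ℂ) * q₂ = N at *
    have e1 : (a : ℂ) * (-1 / (N * w)) + b = -(-b * N * w + a) / (N * w) := by
      field_simp; ring
    have e2 : (c : ℂ) * N * (-1 / (N * w)) + d = (d * w + -c) / w := by
      field_simp; ring
    rw [e1, e2]
    field_simp
  rw [hzz, c1, c2]
  linear_combination (1 / (Real.pi * Complex.I) : ℂ) * f2 -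
    (1 / (Real.pi * Complex.I) : ℂ) * χ₁ (d : ZMod q₁) * χ₂ (a : ZMod q₂) * f1
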